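/- arXiv:2412.08219 — 2 statements merged into one kernel-verified Lean document; each statement's English description precedes it below -/
import Mathlib

section
/- Let f̄, K̄, L_f ≥ 0, let f : [0,1]² → ℝ satisfy |f(a,b)| ≤ f̄ and |f(a₁,b₁) − f(a₂,b₂)| ≤ L_f(|a₁ − a₂| + |b₁ − b₂|) for all points in [0,1]², and let K : T₁ → ℝ satisfy |K(s,q)| ≤ K̄ and the integral equation K(s,q) = ∫_s^{s+1−q} ∫_θ^{θ−s+q} K(θ,r) f(r, θ−s+q) dr dθ − ∫_q^1 f(θ+s−q, θ) dθ for all (s,q) ∈ T₁. Then K is Lipschitz in its first argument: for every q ∈ [0,1] and all s₁, s₂ ∈ [0,q], |K(s₁,q) − K(s₂,q)| ≤ (3 f̄ K̄ + (1 + K̄) L_f) |s₁ − s₂|. -/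
open Set Filter Topology MeasureTheory

/-- A subset of the line that is open to the right of each of its points is Borel. -/
theorem measurableSet_of_mem_nhdsGE {V : Set ℝ} (hV : ∀ x ∈ V, V ∈ 𝓝[≥] x) :
    MeasurableSet V := by
  have hy : ∀ x : ℝ, ∃ y, x < y ∧ (x ∈ V → Ico x y ⊆ V) := by
    intro x
    by_cases hx : x ∈ V
    · obtain ⟨y, hxy, hs⟩ := (mem_nhdsGE_iff_exists_Ico_subset).1 (hV x hx)
      exact ⟨y, hxy, fun _ => hs⟩
    · exact ⟨x + 1, by linarith, fun h => absurd h hx⟩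
  choose y hxy hyV using hy
  have hcount : (V \ interior V).Countable := by
    refine Set.PairwiseDisjoint.countable_of_Ioo (y := y) ?_ fun x _ => hxy x
    have key : ∀ a ∈ V \ interior V, ∀ b ∈ V \ interior V, a < b →
        Disjoint (Ioo a (y a)) (Ioo b (y b)) := by
      intro a ha b hb hab
      have hint : Ioo a (y a) ⊆ interior V :=
        interior_maximal (Ioo_subset_Ico_self.trans (hyV a ha.1)) isOpen_Ioo
      have hle : y a ≤ b := by
        by_contra! h
        exact hb.2 (hint ⟨hab, h⟩)
      rw [Set.disjoint_left]
      intro z hz hz'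
      exact absurd (hz.2.trans_le hle) (not_lt.2 hz'.1.le)
    intro a ha b hb hne
    rcases lt_or_gt_of_ne hne with h | h
    · exact key a ha b hb h
    · exact (key b hb a ha h).symm
  have : V = interior V ∪ (V \ interior V) := by
    rw [Set.union_sdiff_cancel interior_subset]
  rw [this]
  exact isOpen_interior.measurableSet.union hcount.measurableSet

/-- The Bochner integral of a bounded family of functions which is pointwise almost everywhere
continuous in the parameter is Borel in the parameter. No measurability of the members of the family
is required. The notion of convergence in the parameter space is given by neighbourhood filters. -/
theorem measurable_integral_of_tendsto {X R : Type*} [MeasurableSpace X] [MeasurableSpace R]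
    {μ : Measure R} [IsFiniteMeasure μ] (l : X → Filter X) [∀ x, (l x).IsCountablyGenerated]
    (hpure : ∀ x, pure x ≤ l x)
    (hbasis : ∀ x, ∀ s ∈ l x, ∃ V ∈ l x, V ⊆ s ∧ ∀ y ∈ V, V ∈ l y)
    (hmeas : ∀ V : Set X, (∀ x ∈ V, V ∈ l x) → MeasurableSet V)
    (Φ : X → R → ℝ) (C : ℝ) (hC : ∀ x r, |Φ x r| ≤ C)
    (hlim : ∀ x, ∀ᵐ r ∂μ, Tendsto (fun y => Φ y r) (l x) (𝓝 (Φ x r))) :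
    Measurable fun x => ∫ r, Φ x r ∂μ := by
  set A : Set X := {x | AEStronglyMeasurable (Φ x) μ}
  have hAc : MeasurableSet Aᶜ := by
    refine hmeas _ fun x hx => ?_
    by_contra hcon
    have hfreq : ∃ᶠ y in l x, y ∈ A := by
      intro h
      exact hcon h
    have : NeBot (comap (Subtype.val : A → X) (l x)) := by
      rw [comap_neBot_iff_frequently]
      simpa using hfreq
    refine hx (aestronglyMeasurable_of_tendsto_ae (comap (Subtype.val : A → X) (l x))
      (f := fun y : A => Φ y) (fun y => y.2) ?_)
    filter_upwards [hlim x] with r hr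
    exact hr.comp tendsto_comap
  have hT : ∀ x, Tendsto (fun y => ∫ r, Φ y r ∂μ) (l x ⊓ 𝓟 A) (𝓝 (∫ r, Φ x r ∂μ)) := by
    intro x
    refine tendsto_integral_filter_of_dominated_convergence (fun _ => C) ?_ ?_
      (integrable_const C) ?_
    · exact eventually_inf_principal.2 (Eventually.of_forall fun y hy => hy)
    · exact Eventually.of_forall fun y => Eventually.of_forall fun r => hC y r
    · filter_upwards [hlim x] with r hr
      exact hr.mono_left inf_le_left
  refine measurable_of_isOpen fun t ht => ?_
  set V : Set X := {x | ∃ O, x ∈ O ∧ (∀ y ∈ O, O ∈ l y) ∧ ∀ y ∈ O, y ∈ A → ∫ r, Φ y r ∂μ ∈ t}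
  have hV : MeasurableSet V := by
    refine hmeas _ ?_
    rintro x ⟨O, hxO, hO, hOt⟩
    exact mem_of_superset (hO x hxO) fun y hy => ⟨O, hy, hO, hOt⟩
  have : (fun x => ∫ r, Φ x r ∂μ) ⁻¹' t = (A ∩ V) ∪ (Aᶜ ∩ {_x | (0 : ℝ) ∈ t}) := by
    ext x
    by_cases hx : x ∈ A
    · have h1 : x ∈ V ↔ ∫ r, Φ x r ∂μ ∈ t := by
        constructor
        · rintro ⟨O, hxO, hO, hOt⟩
          exact hOt x hxO hx
        · intro h
          have := eventually_inf_principal.1 ((hT x).eventually (ht.mem_nhds h))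
          obtain ⟨O, hO, hOs, hOo⟩ := hbasis x _ this
          exact ⟨O, hpure x hO, hOo, fun y hy => hOs hy⟩
      simp [hx, h1]
    · have h0 : ∫ r, Φ x r ∂μ = 0 := integral_non_aestronglyMeasurable hx
      simp [hx, h0]
  rw [this]
  exact (hAc.of_compl.inter hV).union (hAc.inter (MeasurableSet.const _))

/-- The integral over `s..b` of a bounded function, measurable or not, is right-continuous in
`s`. -/
theorem continuousWithinAt_integral_left {h : ℝ → ℝ} {C : ℝ} (hC : ∀ x, |h x| ≤ C) {s b : ℝ}
    (hs : s ≤ b) : ContinuousWithinAt (fun x => ∫ θ in x..b, h θ) (Icc s b) s := by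
  rcases hs.eq_or_lt with rfl | hsb
  · simp [continuousWithinAt_singleton]
  by_cases hint : IntervalIntegrable h volume s b
  · have := intervalIntegral.continuousOn_primitive_interval_left (f := h) (μ := volume)
      (a := s) (b := b) (by rw [uIcc_of_le hs]
                            exact (intervalIntegrable_iff_integrableOn_Icc_of_le hs).1 hint)
    rw [uIcc_of_le hs] at this
    exact this s (left_mem_Icc.2 hs)
  · obtain ⟨c, hsc, hcb, hc⟩ : ∃ c, s < c ∧ c ≤ b ∧ ¬ IntervalIntegrable h volume c b := by
      by_contra! hcon
      refine hint ?_
      obtain ⟨u, -, hu, hulim⟩ := exists_seq_strictAnti_tendsto' hsb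
      have hm : AEStronglyMeasurable h (volume.restrict (⋃ n, Ioc (u n) b)) := by
        rw [aestronglyMeasurable_iUnion_iff]
        intro n
        have := (intervalIntegrable_iff_integrableOn_Ioc_of_le (hu n).2.le).1
          (hcon (u n) (hu n).1 (hu n).2.le)
        exact this.aestronglyMeasurable
      have hU : (⋃ n, Ioc (u n) b) = Ioc s b := by
        ext x
        simp only [mem_iUnion, mem_Ioc]
        constructor
        · rintro ⟨n, h1, h2⟩
          exact ⟨(hu n).1.trans h1, h2⟩
        · rintro ⟨h1, h2⟩
          obtain ⟨n, hn⟩ := (hulim.eventually (gt_mem_nhds h1)).exists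
          exact ⟨n, hn, h2⟩
      rw [hU] at hm
      rw [intervalIntegrable_iff_integrableOn_Ioc_of_le hs]
      exact Integrable.of_bound hm C
        (Eventually.of_forall fun x => hC x)
    have hzero : ∀ x ∈ Icc s c, ∫ θ in x..b, h θ = 0 := by
      intro x hx
      refine intervalIntegral.integral_undef fun hi => hc (hi.mono_set ?_)
      rw [uIcc_of_le hcb, uIcc_of_le (hx.2.trans hcb)]
      exact Icc_subset_Icc_left hx.2
    have : (fun x => ∫ θ in x..b, h θ) =ᶠ[𝓝[Icc s b] s] fun _ => 0 := by
      filter_upwards [self_mem_nhdsWithin, nhdsWithin_le_nhds (Iio_mem_nhds hsc)] with x hx hx'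
      exact hzero x ⟨hx.1, le_of_lt hx'⟩
    exact continuousWithinAt_const.congr_of_eventuallyEq this (hzero s ⟨le_rfl, hsc.le⟩)

/-- The inner integral of the kernel equation along the diagonal of offset `d`, for a kernel given as
`k θ e = K(θ, θ + e)`. -/
noncomputable def innerIntegral (k f : ℝ → ℝ → ℝ) (θ d : ℝ) : ℝ :=
  ∫ r in Ioc (0 : ℝ) 1, (Ioc (0 : ℝ) d).indicator (fun r => k θ r * f (θ + r) (θ + d)) r

theorem innerIntegral_eq {k f : ℝ → ℝ → ℝ} {θ d : ℝ} (hd : d ∈ Icc (0 : ℝ) 1) :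
    innerIntegral k f θ d = ∫ r in (0 : ℝ)..d, k θ r * f (θ + r) (θ + d) := by
  rw [innerIntegral, setIntegral_indicator measurableSet_Ioc,
    inter_eq_right.2 (Ioc_subset_Ioc_right hd.2), intervalIntegral.integral_of_le hd.1]

/-- A bounded solution of the kernel equation in diagonal coordinates `k s d = K(s, s + d)`,
extended to the whole plane by freezing `s` outside `[0, 1 - d]`. -/
structure IsDiagonalKernel (k f : ℝ → ℝ → ℝ) (Kbar fbar : ℝ) : Prop where
  continuous_source : Continuous (Function.uncurry f)
  abs_source_le : ∀ a b, |f a b| ≤ fbar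
  abs_le : ∀ s d, |k s d| ≤ Kbar
  clamp : ∀ d ∈ Icc (0 : ℝ) 1, ∀ s, k s d = k (max 0 (min (1 - d) s)) d
  equation : ∀ d ∈ Icc (0 : ℝ) 1, ∀ s ∈ Icc (0 : ℝ) (1 - d),
    k s d = (∫ θ in s..(1 - d), innerIntegral k f θ d) - ∫ θ in (s + d)..1, f (θ - d) θ

namespace IsDiagonalKernel

variable {k f : ℝ → ℝ → ℝ} {Kbar fbar : ℝ}

theorem abs_mul_le (h : IsDiagonalKernel k f Kbar fbar) (s d a b : ℝ) :
    |k s d * f a b| ≤ fbar * Kbar := by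
  rw [abs_mul, mul_comm]
  exact mul_le_mul (h.abs_source_le _ _) (h.abs_le _ _) (abs_nonneg _)
    ((abs_nonneg _).trans (h.abs_source_le 0 0))

theorem abs_indicator_le (h : IsDiagonalKernel k f Kbar fbar) (θ d r : ℝ) :
    |(Ioc (0 : ℝ) d).indicator (fun r => k θ r * f (θ + r) (θ + d)) r| ≤ fbar * Kbar := by
  by_cases hr : r ∈ Ioc (0 : ℝ) d
  · rw [indicator_of_mem hr]
    exact h.abs_mul_le _ _ _ _
  · rw [indicator_of_notMem hr, abs_zero]
    exact (abs_nonneg _).trans (h.abs_mul_le 0 0 0 0)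

theorem abs_innerIntegral_le (h : IsDiagonalKernel k f Kbar fbar) (θ d : ℝ) :
    |innerIntegral k f θ d| ≤ fbar * Kbar := by
  have := norm_setIntegral_le_of_norm_le_const (μ := volume) (s := Ioc (0 : ℝ) 1)
    (f := (Ioc (0 : ℝ) d).indicator (fun r => k θ r * f (θ + r) (θ + d)))
    (C := fbar * Kbar) (by simp) (fun r _ => h.abs_indicator_le θ d r)
  simpa [innerIntegral] using this

theorem mapsTo_clamp {d : ℝ} (hd : d ∈ Icc (0 : ℝ) 1) (s : ℝ) :
    max 0 (min (1 - d) s) ∈ Icc (0 : ℝ) (1 - d) :=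
  ⟨le_max_left _ _, max_le (by linarith [hd.2]) (min_le_left _ _)⟩

theorem eq_clamp (h : IsDiagonalKernel k f Kbar fbar) {d : ℝ} (hd : d ∈ Icc (0 : ℝ) 1) (s : ℝ) :
    k s d = (∫ θ in (max 0 (min (1 - d) s))..(1 - d), innerIntegral k f θ d)
      - ∫ θ in (max 0 (min (1 - d) s) + d)..1, f (θ - d) θ := by
  rw [h.clamp d hd, h.equation d hd _ (mapsTo_clamp hd s)]

theorem continuous_source_integral (h : IsDiagonalKernel k f Kbar fbar) {p d : ℝ → ℝ}
    (hp : Continuous p) (hd : Continuous d) :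
    Continuous fun x => ∫ θ in (p x)..1, f (θ - d x) θ := by
  have hc : Continuous (Function.uncurry fun x θ => f (θ - d x) θ) :=
    h.continuous_source.comp
      ((continuous_snd.sub (hd.comp continuous_fst)).prodMk continuous_snd)
  have := intervalIntegral.continuous_parametric_intervalIntegral_of_continuous
    (μ := volume) (a₀ := 1) hc hp
  exact this.neg.congr fun x => (intervalIntegral.integral_symm _ _).symm

theorem continuousWithinAt_left (h : IsDiagonalKernel k f Kbar fbar) {d : ℝ}
    (hd : d ∈ Icc (0 : ℝ) 1) (s : ℝ) : ContinuousWithinAt (fun s => k s d) (Ici s) s := by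
  have hcl : Continuous fun s : ℝ => max 0 (min (1 - d) s) := by fun_prop
  have h1 := (continuousWithinAt_integral_left (fun θ => h.abs_innerIntegral_le θ d)
    (mapsTo_clamp hd s).2).comp (f := fun s : ℝ => max 0 (min (1 - d) s)) (s := Ici s)
    hcl.continuousWithinAt fun x hx =>
      ⟨max_le_max le_rfl (min_le_min le_rfl hx), (mapsTo_clamp hd x).2⟩
  have h2 := h.continuous_source_integral (hcl.add (continuous_const (y := d)))
    (continuous_const (y := d))
  exact (h1.sub h2.continuousWithinAt).congr (fun x _ => h.eq_clamp hd x) (h.eq_clamp hd s)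

theorem measurable_innerIntegral_left (h : IsDiagonalKernel k f Kbar fbar) (d : ℝ) :
    Measurable fun θ => innerIntegral k f θ d := by
  refine measurable_integral_of_tendsto (fun x : ℝ => 𝓝[≥] x)
    (fun x => pure_le_nhdsWithin (mem_Ici.2 le_rfl))
    ?_ (fun V => measurableSet_of_mem_nhdsGE) _ _ (fun θ r => h.abs_indicator_le θ d r) ?_
  · intro x s hs
    obtain ⟨y, hxy, hys⟩ := mem_nhdsGE_iff_exists_Ico_subset.1 hs
    exact ⟨Ico x y, Ico_mem_nhdsGE hxy, hys, fun z hz =>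
      mem_of_superset (Ico_mem_nhdsGE hz.2) (Ico_subset_Ico_left hz.1)⟩
  · intro θ
    filter_upwards [ae_restrict_mem measurableSet_Ioc] with r hr
    by_cases hrd : r ∈ Ioc (0 : ℝ) d
    · simp only [indicator_of_mem hrd]
      have hf : Continuous fun θ => f (θ + r) (θ + d) :=
        h.continuous_source.comp (by fun_prop : Continuous fun θ : ℝ => (θ + r, θ + d))
      exact (h.continuousWithinAt_left (Ioc_subset_Icc_self hr) θ).mul hf.continuousWithinAt
    · simp only [indicator_of_notMem hrd]
      exact tendsto_const_nhds

theorem intervalIntegrable_innerIntegral (h : IsDiagonalKernel k f Kbar fbar) (d a b : ℝ) :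
    IntervalIntegrable (fun θ => innerIntegral k f θ d) volume a b := by
  refine (intervalIntegrable_const (c := fbar * Kbar)).mono_fun'
    (h.measurable_innerIntegral_left d).aestronglyMeasurable ?_
  exact Eventually.of_forall fun θ => h.abs_innerIntegral_le θ d

theorem continuous_left (h : IsDiagonalKernel k f Kbar fbar) {d : ℝ} (hd : d ∈ Icc (0 : ℝ) 1) :
    Continuous fun s => k s d := by
  have hcl : Continuous fun s : ℝ => max 0 (min (1 - d) s) := by fun_prop
  have h1 : Continuous fun s => ∫ θ in s..(1 - d), innerIntegral k f θ d := by
    refine (intervalIntegral.continuous_primitive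
      (fun a b => h.intervalIntegrable_innerIntegral d a b) (1 - d)).neg.congr fun x => ?_
    exact (intervalIntegral.integral_symm _ _).symm
  have h2 := h.continuous_source_integral (hcl.add (continuous_const (y := d)))
    (continuous_const (y := d))
  exact ((h1.comp hcl).sub h2).congr fun x => (h.eq_clamp hd x).symm

theorem measurable_uncurry_innerIntegral (h : IsDiagonalKernel k f Kbar fbar) :
    Measurable (Function.uncurry (innerIntegral k f)) := by
  refine measurable_integral_of_tendsto (fun x : ℝ × ℝ => 𝓝 x) pure_le_nhds
    ?_ (fun V hV => (isOpen_iff_mem_nhds.2 hV).measurableSet)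
    (fun x r => (Ioc (0 : ℝ) x.2).indicator (fun r => k x.1 r * f (x.1 + r) (x.1 + x.2)) r) _
    (fun x r => h.abs_indicator_le x.1 x.2 r) ?_
  · intro x s hs
    obtain ⟨V, hVs, hV, hxV⟩ := mem_nhds_iff.1 hs
    exact ⟨V, hV.mem_nhds hxV, hVs, fun y hy => hV.mem_nhds hy⟩
  · rintro ⟨θ, d⟩
    filter_upwards [ae_restrict_mem measurableSet_Ioc,
      (Measure.ae_ne (volume.restrict (Ioc (0 : ℝ) 1)) d)] with r hr hrd
    rcases lt_or_gt_of_ne hrd with hlt | hgt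
    · have hf : Continuous fun x : ℝ × ℝ => f (x.1 + r) (x.1 + x.2) :=
        h.continuous_source.comp
          (by fun_prop : Continuous fun x : ℝ × ℝ => (x.1 + r, x.1 + x.2))
      have hT := (((h.continuous_left (Ioc_subset_Icc_self hr)).comp continuous_fst).mul
        hf).tendsto (θ, d)
      rw [indicator_of_mem (show r ∈ Ioc (0 : ℝ) (θ, d).2 from ⟨hr.1, hlt.le⟩)]
      refine hT.congr' ?_
      filter_upwards [continuous_snd.continuousAt.eventually (lt_mem_nhds hlt)] with x hx
      rw [indicator_of_mem (show r ∈ Ioc (0 : ℝ) x.2 from ⟨hr.1, le_of_lt hx⟩)]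
      rfl
    · rw [indicator_of_notMem (show r ∉ Ioc (0 : ℝ) (θ, d).2 from fun hr' => not_lt.2 hr'.2 hgt)]
      refine tendsto_const_nhds.congr' ?_
      filter_upwards [continuous_snd.continuousAt.eventually (gt_mem_nhds hgt)] with x hx
      rw [indicator_of_notMem (show r ∉ Ioc (0 : ℝ) x.2 from fun hr' => not_lt.2 hr'.2 hx)]

theorem aestronglyMeasurable_right (h : IsDiagonalKernel k f Kbar fbar) (s : ℝ) :
    AEStronglyMeasurable (k s) (volume.restrict (Ioc (0 : ℝ) 1)) := by
  have hcl : Continuous fun d : ℝ => max 0 (min (1 - d) s) := by fun_prop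
  set S : Set (ℝ × ℝ) := {x | max 0 (min (1 - x.1) s) < x.2 ∧ x.2 ≤ 1 - x.1} with hSdef
  have hS : MeasurableSet S := by
    rw [hSdef, ofPred_and]
    refine (measurableSet_lt ?_ ?_).inter (measurableSet_le ?_ ?_) <;> fun_prop
  have hm : Measurable fun d => ∫ θ, S.indicator (fun x => innerIntegral k f x.2 x.1) (d, θ) :=
    (((h.measurable_uncurry_innerIntegral.comp measurable_swap).indicator
      hS).stronglyMeasurable.integral_prod_right').measurable
  have h2 := h.continuous_source_integral (hcl.add continuous_id) continuous_id
  refine (hm.sub h2.measurable).aestronglyMeasurable.congr ?_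
  filter_upwards [ae_restrict_mem measurableSet_Ioc] with d hd
  have hd' := Ioc_subset_Icc_self hd
  rw [h.eq_clamp hd' s, intervalIntegral.integral_of_le (mapsTo_clamp hd' s).2,
    ← integral_indicator measurableSet_Ioc]
  rfl

theorem intervalIntegrable_integrand (h : IsDiagonalKernel k f Kbar fbar) (θ c : ℝ) {a b : ℝ}
    (ha : a ∈ Icc (0 : ℝ) 1) (hb : b ∈ Icc (0 : ℝ) 1) :
    IntervalIntegrable (fun r => k θ r * f (θ + r) c) volume a b := by
  refine (intervalIntegrable_const (c := fbar * Kbar)).mono_fun' ?_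
    (Eventually.of_forall fun r => h.abs_mul_le _ _ _ _)
  have hf : Continuous fun r => f (θ + r) c :=
    h.continuous_source.comp (by fun_prop : Continuous fun r : ℝ => (θ + r, c))
  refine ((h.aestronglyMeasurable_right θ).mul hf.aestronglyMeasurable).mono_measure
    (Measure.restrict_mono ?_ le_rfl)
  exact Ioc_subset_Ioc (le_min ha.1 hb.1) (max_le ha.2 hb.2)

theorem abs_innerIntegral_sub_le (h : IsDiagonalKernel k f Kbar fbar) {Lf : ℝ}
    (hlip : ∀ a b₁ b₂, |f a b₁ - f a b₂| ≤ Lf * |b₁ - b₂|) (θ : ℝ) {d₁ d₂ : ℝ}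
    (hd₁ : d₁ ∈ Icc (0 : ℝ) 1) (hd₂ : d₂ ∈ Icc (0 : ℝ) 1) :
    |innerIntegral k f θ d₁ - innerIntegral k f θ d₂| ≤
      (fbar * Kbar + Kbar * Lf) * |d₁ - d₂| := by
  have h0 : (0 : ℝ) ∈ Icc (0 : ℝ) 1 := ⟨le_rfl, zero_le_one⟩
  have hK : 0 ≤ Kbar := (abs_nonneg _).trans (h.abs_le 0 0)
  have hsplit : innerIntegral k f θ d₁ - innerIntegral k f θ d₂ =
      (∫ r in (0 : ℝ)..d₂, (k θ r * f (θ + r) (θ + d₁) - k θ r * f (θ + r) (θ + d₂)))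
        + ∫ r in d₂..d₁, k θ r * f (θ + r) (θ + d₁) := by
    rw [innerIntegral_eq hd₁, innerIntegral_eq hd₂,
      intervalIntegral.integral_sub (h.intervalIntegrable_integrand _ _ h0 hd₂)
        (h.intervalIntegrable_integrand _ _ h0 hd₂),
      ← intervalIntegral.integral_add_adjacent_intervals
        (h.intervalIntegrable_integrand θ (θ + d₁) h0 hd₂)
        (h.intervalIntegrable_integrand _ _ hd₂ hd₁)]
    ring
  have hlip' : ∀ r, |k θ r * f (θ + r) (θ + d₁) - k θ r * f (θ + r) (θ + d₂)| ≤
      Kbar * (Lf * |d₁ - d₂|) := by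
    intro r
    rw [← mul_sub, abs_mul]
    have := hlip (θ + r) (θ + d₁) (θ + d₂)
    rw [add_sub_add_left_eq_sub] at this
    exact mul_le_mul (h.abs_le _ _) this (abs_nonneg _) hK
  have e1 := intervalIntegral.norm_integral_le_of_norm_le_const (a := 0) (b := d₂)
    (f := fun r => k θ r * f (θ + r) (θ + d₁) - k θ r * f (θ + r) (θ + d₂))
    (fun r _ => hlip' r)
  have e2 := intervalIntegral.norm_integral_le_of_norm_le_const (a := d₂) (b := d₁)
    (f := fun r => k θ r * f (θ + r) (θ + d₁)) (fun r _ => h.abs_mul_le _ _ _ _)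
  rw [Real.norm_eq_abs] at e1 e2
  have e3 : Kbar * (Lf * |d₁ - d₂|) * |d₂ - 0| ≤ Kbar * (Lf * |d₁ - d₂|) := by
    refine mul_le_of_le_one_right ((abs_nonneg _).trans (hlip' 0)) ?_
    rw [sub_zero, abs_of_nonneg hd₂.1]
    exact hd₂.2
  rw [hsplit]
  refine (abs_add_le _ _).trans ?_
  linarith

theorem abs_sub_le (h : IsDiagonalKernel k f Kbar fbar) {Lf : ℝ}
    (hlip : ∀ a₁ b₁ a₂ b₂, |f a₁ b₁ - f a₂ b₂| ≤ Lf * (|a₁ - a₂| + |b₁ - b₂|))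
    {q s₁ s₂ : ℝ} (hq : q ∈ Icc (0 : ℝ) 1) (hs₁ : s₁ ∈ Icc (0 : ℝ) q) (hs₂ : s₂ ∈ Icc (0 : ℝ) q) :
    |k s₁ (q - s₁) - k s₂ (q - s₂)| ≤
      (3 * fbar * Kbar + (1 + Kbar) * Lf) * |s₁ - s₂| := by
  wlog hle : s₁ ≤ s₂ generalizing s₁ s₂
  · rw [abs_sub_comm, abs_sub_comm s₁]
    exact this hs₂ hs₁ (le_of_not_ge hle)
  have hd : ∀ s ∈ Icc (0 : ℝ) q, q - s ∈ Icc (0 : ℝ) 1 := fun s hs =>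
    ⟨by linarith [hs.2], by linarith [hs.1, hq.2]⟩
  have hs : ∀ s ∈ Icc (0 : ℝ) q, s ∈ Icc (0 : ℝ) (1 - (q - s)) := fun s hs =>
    ⟨hs.1, by linarith [hq.2]⟩
  have hsource : |(∫ θ in q..1, f (θ - (q - s₁)) θ) - ∫ θ in q..1, f (θ - (q - s₂)) θ| ≤
      Lf * |s₁ - s₂| := by
    have hc : ∀ d, IntervalIntegrable (fun θ => f (θ - d) θ) volume q 1 := fun d =>
      (h.continuous_source.comp
        (by fun_prop : Continuous fun θ : ℝ => (θ - d, θ))).intervalIntegrable _ _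
    rw [← intervalIntegral.integral_sub (hc _) (hc _)]
    have hb : ∀ θ, |f (θ - (q - s₁)) θ - f (θ - (q - s₂)) θ| ≤ Lf * |s₁ - s₂| := by
      intro θ
      refine (hlip _ _ _ _).trans_eq ?_
      rw [sub_self, abs_zero, add_zero]
      congr 2
      ring
    refine (intervalIntegral.norm_integral_le_of_norm_le_const
      (f := fun θ => f (θ - (q - s₁)) θ - f (θ - (q - s₂)) θ) fun θ _ => hb θ).trans ?_
    refine mul_le_of_le_one_right ((abs_nonneg _).trans (hb 0)) ?_
    rw [abs_of_nonneg (by linarith [hq.2])]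
    linarith [hq.1]
  have hi := h.intervalIntegrable_innerIntegral
  set b₁ := 1 - (q - s₁) with hb₁
  set b₂ := 1 - (q - s₂) with hb₂
  have hsplit : (∫ θ in s₁..b₁, innerIntegral k f θ (q - s₁))
      - ∫ θ in s₂..b₂, innerIntegral k f θ (q - s₂) =
      (∫ θ in s₁..s₂, innerIntegral k f θ (q - s₁))
      + (∫ θ in s₂..b₁, (innerIntegral k f θ (q - s₁) - innerIntegral k f θ (q - s₂)))
      - ∫ θ in b₁..b₂, innerIntegral k f θ (q - s₂) := by
    rw [intervalIntegral.integral_sub (hi _ _ _) (hi _ _ _),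
      ← intervalIntegral.integral_add_adjacent_intervals (hi (q - s₁) s₁ s₂) (hi _ s₂ b₁),
      ← intervalIntegral.integral_add_adjacent_intervals (hi (q - s₂) s₂ b₁) (hi _ b₁ b₂)]
    ring
  have e1 := intervalIntegral.norm_integral_le_of_norm_le_const (a := s₁) (b := s₂)
    (f := fun θ => innerIntegral k f θ (q - s₁)) (fun θ _ => h.abs_innerIntegral_le _ _)
  have e3 := intervalIntegral.norm_integral_le_of_norm_le_const (a := b₁) (b := b₂)
    (f := fun θ => innerIntegral k f θ (q - s₂)) (fun θ _ => h.abs_innerIntegral_le _ _)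
  have hdiff : ∀ θ, |innerIntegral k f θ (q - s₁) - innerIntegral k f θ (q - s₂)| ≤
      (fbar * Kbar + Kbar * Lf) * |s₁ - s₂| := by
    intro θ
    have := h.abs_innerIntegral_sub_le (Lf := Lf)
      (fun a b c => by simpa using hlip a b a c) θ (hd s₁ hs₁) (hd s₂ hs₂)
    rwa [sub_sub_sub_cancel_left, abs_sub_comm s₂] at this
  have e2 := intervalIntegral.norm_integral_le_of_norm_le_const (a := s₂) (b := b₁)
    (f := fun θ => innerIntegral k f θ (q - s₁) - innerIntegral k f θ (q - s₂))
    (fun θ _ => hdiff θ)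
  have e2' : (fbar * Kbar + Kbar * Lf) * |s₁ - s₂| * |b₁ - s₂| ≤
      (fbar * Kbar + Kbar * Lf) * |s₁ - s₂| := by
    refine mul_le_of_le_one_right ((abs_nonneg _).trans (hdiff 0)) ?_
    rw [_root_.abs_le]
    constructor <;> linarith [hq.1, hq.2, hs₁.1, hs₂.2]
  have hb : b₂ - b₁ = s₂ - s₁ := by rw [hb₁, hb₂]; ring
  rw [hb] at e3
  rw [abs_sub_comm s₂] at e1 e3
  rw [Real.norm_eq_abs] at e1 e2 e3
  rw [h.equation _ (hd s₁ hs₁) _ (hs s₁ hs₁), h.equation _ (hd s₂ hs₂) _ (hs s₂ hs₂),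
    add_sub_cancel, add_sub_cancel, sub_sub_sub_comm, hsplit]
  refine (_root_.abs_sub _ _).trans ?_
  refine (add_le_add ((_root_.abs_sub _ _).trans (add_le_add_left (abs_add_le _ _) _))
    hsource).trans ?_
  linarith

end IsDiagonalKernel

/-- The nearest-point retraction of the line onto `[0, b]`. -/
def clampTo (b x : ℝ) : ℝ := max 0 (min b x)

theorem clampTo_mem {b : ℝ} (hb : 0 ≤ b) (x : ℝ) : clampTo b x ∈ Icc (0 : ℝ) b :=
  ⟨le_max_left _ _, max_le hb (min_le_left _ _)⟩

theorem clampTo_of_mem {b x : ℝ} (hx : x ∈ Icc (0 : ℝ) b) : clampTo b x = x := by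
  rw [clampTo, min_eq_right hx.2, max_eq_right hx.1]

theorem continuous_clampTo (b : ℝ) : Continuous (clampTo b) := by
  unfold clampTo
  fun_prop

theorem abs_clampTo_sub_le (b x y : ℝ) : |clampTo b x - clampTo b y| ≤ |x - y| := by
  unfold clampTo
  calc |max 0 (min b x) - max 0 (min b y)| ≤ |min b x - min b y| := by
        simpa using abs_max_sub_max_le_max 0 (min b x) 0 (min b y)
    _ ≤ |x - y| := by simpa using abs_min_sub_min_le_max b x b y

theorem isDiagonalKernel_of_equation {fbar Kbar Lf : ℝ} {f K : ℝ → ℝ → ℝ}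
    (hfb : ∀ a ∈ Icc (0:ℝ) 1, ∀ b ∈ Icc (0:ℝ) 1, |f a b| ≤ fbar)
    (hflip : ∀ a₁ b₁ a₂ b₂, |f (clampTo 1 a₁) (clampTo 1 b₁) - f (clampTo 1 a₂) (clampTo 1 b₂)| ≤
      Lf * (|a₁ - a₂| + |b₁ - b₂|))
    (hKb : ∀ s q : ℝ, 0 ≤ s → s ≤ q → q ≤ 1 → |K s q| ≤ Kbar)
    (hKeq : ∀ s q : ℝ, 0 ≤ s → s ≤ q → q ≤ 1 →
      K s q = (∫ θ in s..(s + 1 - q), ∫ r in θ..(θ - s + q), K θ r * f r (θ - s + q))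
        - ∫ θ in q..(1:ℝ), f (θ + s - q) θ) :
    IsDiagonalKernel
      (fun s d => K (clampTo (1 - clampTo 1 d) s) (clampTo (1 - clampTo 1 d) s + clampTo 1 d))
      (fun a b => f (clampTo 1 a) (clampTo 1 b)) Kbar fbar where
  continuous_source := by
    rw [continuous_iff_continuousAt]
    rintro ⟨a, b⟩
    rw [ContinuousAt, tendsto_iff_dist_tendsto_zero]
    have hc : Continuous fun x : ℝ × ℝ => Lf * (|x.1 - a| + |x.2 - b|) := by fun_prop
    have h0 := hc.tendsto (a, b)
    simp only [sub_self, abs_zero, add_zero, mul_zero] at h0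
    exact squeeze_zero (fun _ => dist_nonneg) (fun x => hflip x.1 x.2 a b) h0
  abs_source_le a b := hfb _ (clampTo_mem zero_le_one a) _ (clampTo_mem zero_le_one b)
  abs_le s d := by
    have hd := clampTo_mem zero_le_one d
    have hs := clampTo_mem (sub_nonneg.2 hd.2) s
    exact hKb _ _ hs.1 (by linarith [hd.1]) (by linarith [hs.2])
  clamp d hd s := by
    have hs := clampTo_mem (sub_nonneg.2 hd.2) s
    simp only [clampTo_of_mem hd]
    rw [← clampTo, clampTo_of_mem hs]
  equation d hd s hs := by
    simp only [clampTo_of_mem hd, clampTo_of_mem hs]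
    have h0 := hd.1
    have h1 := hs.1
    have h2 := hs.2
    rw [hKeq s (s + d) hs.1 (by linarith) (by linarith), show s + 1 - (s + d) = 1 - d by ring]
    congr 1
    · refine intervalIntegral.integral_congr fun θ hθ => ?_
      rw [uIcc_of_le h2] at hθ
      simp only [innerIntegral_eq hd, show θ - s + (s + d) = θ + d by ring]
      have hsub := intervalIntegral.integral_comp_add_left (a := 0) (b := d)
        (fun r => K θ r * f r (θ + d)) θ
      rw [add_zero] at hsub
      rw [← hsub]
      refine intervalIntegral.integral_congr fun r hr => ?_
      rw [uIcc_of_le h0] at hr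
      have hθ1 := hθ.1
      have hθ2 := hθ.2
      have hr1 := hr.1
      have hr2 := hr.2
      rw [clampTo_of_mem (show r ∈ Icc (0 : ℝ) 1 from ⟨hr1, hr2.trans hd.2⟩),
        clampTo_of_mem (show θ ∈ Icc (0 : ℝ) (1 - r) from ⟨by linarith, by linarith⟩),
        clampTo_of_mem (show θ + r ∈ Icc (0 : ℝ) 1 from ⟨by linarith, by linarith⟩),
        clampTo_of_mem (show θ + d ∈ Icc (0 : ℝ) 1 from ⟨by linarith, by linarith⟩)]
    · refine intervalIntegral.integral_congr fun θ hθ => ?_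
      rw [uIcc_of_le (by linarith)] at hθ
      have hθ1 := hθ.1
      have hθ2 := hθ.2
      rw [show θ + s - (s + d) = θ - d by ring,
        clampTo_of_mem (show θ - d ∈ Icc (0 : ℝ) 1 from ⟨by linarith, by linarith⟩),
        clampTo_of_mem (show θ ∈ Icc (0 : ℝ) 1 from ⟨by linarith, by linarith⟩)]

/-- If |f| ≤ f̄ and f is Lipschitz with constant L_f on [0,1]², and K is a
bounded (by K̄) solution on T₁ = {0 ≤ s ≤ q ≤ 1} of the kernel equation
K(s,q) = ∫_s^{s+1−q} ∫_θ^{θ−s+q} K(θ,r) f(r, θ−s+q) dr dθ − ∫_q^1 f(θ+s−q, θ) dθ,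
then K is Lipschitz in its first argument with constant 3 f̄ K̄ + (1 + K̄) L_f. -/
theorem stmt_5 (fbar Kbar Lf : ℝ) (hfbar : 0 ≤ fbar) (hKbar : 0 ≤ Kbar) (hLf : 0 ≤ Lf)
    (f : ℝ → ℝ → ℝ)
    (hfb : ∀ a ∈ Icc (0:ℝ) 1, ∀ b ∈ Icc (0:ℝ) 1, |f a b| ≤ fbar)
    (hflip : ∀ a₁ ∈ Icc (0:ℝ) 1, ∀ b₁ ∈ Icc (0:ℝ) 1, ∀ a₂ ∈ Icc (0:ℝ) 1, ∀ b₂ ∈ Icc (0:ℝ) 1,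
      |f a₁ b₁ - f a₂ b₂| ≤ Lf * (|a₁ - a₂| + |b₁ - b₂|))
    (K : ℝ → ℝ → ℝ)
    (hKb : ∀ s q : ℝ, 0 ≤ s → s ≤ q → q ≤ 1 → |K s q| ≤ Kbar)
    (hKeq : ∀ s q : ℝ, 0 ≤ s → s ≤ q → q ≤ 1 →
      K s q = (∫ θ in s..(s + 1 - q), ∫ r in θ..(θ - s + q), K θ r * f r (θ - s + q))
        - ∫ θ in q..(1:ℝ), f (θ + s - q) θ) :
    ∀ q ∈ Icc (0:ℝ) 1, ∀ s₁ ∈ Icc (0:ℝ) q, ∀ s₂ ∈ Icc (0:ℝ) q,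
      |K s₁ q - K s₂ q| ≤ (3 * fbar * Kbar + (1 + Kbar) * Lf) * |s₁ - s₂| := by
  have hlip : ∀ a₁ b₁ a₂ b₂,
      |f (clampTo 1 a₁) (clampTo 1 b₁) - f (clampTo 1 a₂) (clampTo 1 b₂)| ≤
        Lf * (|a₁ - a₂| + |b₁ - b₂|) := fun a₁ b₁ a₂ b₂ =>
    (hflip _ (clampTo_mem zero_le_one _) _ (clampTo_mem zero_le_one _) _
      (clampTo_mem zero_le_one _) _ (clampTo_mem zero_le_one _)).trans
      (mul_le_mul_of_nonneg_left
        (add_le_add (abs_clampTo_sub_le 1 a₁ a₂) (abs_clampTo_sub_le 1 b₁ b₂)) hLf)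
  intro q hq s₁ hs₁ s₂ hs₂
  have hk : ∀ s ∈ Icc (0 : ℝ) q, K (clampTo (1 - clampTo 1 (q - s)) s)
      (clampTo (1 - clampTo 1 (q - s)) s + clampTo 1 (q - s)) = K s q := by
    intro s hs
    have h1 := hs.1
    have h2 := hs.2
    have h3 := hq.2
    rw [clampTo_of_mem (show q - s ∈ Icc (0 : ℝ) 1 from ⟨by linarith, by linarith⟩),
      clampTo_of_mem (show s ∈ Icc (0 : ℝ) (1 - (q - s)) from ⟨h1, by linarith⟩),
      add_sub_cancel]
  have := (isDiagonalKernel_of_equation hfb hlip hKb hKeq).abs_sub_le hlip hq hs₁ hs₂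
  rwa [hk s₁ hs₁, hk s₂ hs₂] at this
end

section
/- Let f : [0,1]² → ℝ be continuous with |f(a,b)| ≤ f̄ for all (a,b) ∈ [0,1]². Then there exists exactly one continuous function K : T₁ → ℝ satisfying K(s,q) = ∫_s^{s+1−q} ∫_θ^{θ−s+q} K(θ,r) f(r, θ−s+q) dr dθ − ∫_q^1 f(θ+s−q, θ) dθ for all (s,q) ∈ T₁, and this solution satisfies |K(s,q)| ≤ f̄ e^{f̄(1−s)} ≤ f̄ e^{f̄} for all (s,q) ∈ T₁. -/
open Set

/-- The triangle T₁ = {(s,q) ∈ ℝ² : 0 ≤ s ≤ q ≤ 1}. -/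
def T1 : Set (ℝ × ℝ) := {p | 0 ≤ p.1 ∧ p.1 ≤ p.2 ∧ p.2 ≤ 1}

/-- The double integral term `Ψ₁` of the kernel equation. -/
noncomputable def kernelOp (f K : ℝ → ℝ → ℝ) (s q : ℝ) : ℝ :=
  ∫ θ in s..(s + 1 - q), ∫ r in θ..(θ - s + q), K θ r * f r (θ - s + q)

/-- The source term `Ξ₁` of the kernel equation. -/
noncomputable def kernelSource (f : ℝ → ℝ → ℝ) (s q : ℝ) : ℝ :=
  ∫ θ in q..(1 : ℝ), f (θ + s - q) θ

lemma kernelOp_congr {f f' K K' : ℝ → ℝ → ℝ}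
    (hf : ∀ a ∈ Icc (0 : ℝ) 1, ∀ b ∈ Icc (0 : ℝ) 1, f a b = f' a b)
    (hK : ∀ s q, (s, q) ∈ T1 → K s q = K' s q) {s q : ℝ} (h : (s, q) ∈ T1) :
    kernelOp f K s q = kernelOp f' K' s q := by
  obtain ⟨h0, h1, h2⟩ := h
  dsimp only at h0 h1 h2
  refine intervalIntegral.integral_congr fun θ hθ => ?_
  rw [uIcc_of_le (by linarith)] at hθ
  refine intervalIntegral.integral_congr fun r hr => ?_
  rw [uIcc_of_le (by linarith)] at hr
  obtain ⟨ha, hb⟩ := hθ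
  obtain ⟨hc, hd⟩ := hr
  rw [hf r ⟨by linarith, by linarith⟩ _ ⟨by linarith, by linarith⟩,
    hK θ r ⟨by dsimp only; linarith, hc, by dsimp only; linarith⟩]

lemma kernelSource_congr {f f' : ℝ → ℝ → ℝ}
    (hf : ∀ a ∈ Icc (0 : ℝ) 1, ∀ b ∈ Icc (0 : ℝ) 1, f a b = f' a b)
    {s q : ℝ} (h : (s, q) ∈ T1) : kernelSource f s q = kernelSource f' s q := by
  obtain ⟨h0, h1, h2⟩ := h
  dsimp only at h0 h1 h2
  refine intervalIntegral.integral_congr fun θ hθ => ?_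
  rw [uIcc_of_le h2] at hθ
  obtain ⟨ha, hb⟩ := hθ
  exact hf _ ⟨by linarith, by linarith⟩ _ ⟨by linarith, hb⟩

lemma continuous_kernelOp_inner {f K : ℝ → ℝ → ℝ} (hf : Continuous (Function.uncurry f))
    (hK : Continuous (Function.uncurry K)) :
    Continuous fun x : (ℝ × ℝ) × ℝ =>
      ∫ r in x.2..(x.2 - x.1.1 + x.1.2), K x.2 r * f r (x.2 - x.1.1 + x.1.2) := by
  have hbody : Continuous fun y : ((ℝ × ℝ) × ℝ) × ℝ =>
      K y.1.2 y.2 * f y.2 (y.1.2 - y.1.1.1 + y.1.1.2) :=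
    (hK.comp (by fun_prop : Continuous fun y : ((ℝ × ℝ) × ℝ) × ℝ => (y.1.2, y.2))).mul
      (hf.comp (by fun_prop : Continuous fun y : ((ℝ × ℝ) × ℝ) × ℝ =>
        (y.2, y.1.2 - y.1.1.1 + y.1.1.2)))
  have hsub := intervalIntegral.continuous_parametric_intervalIntegral_of_continuous
    (μ := MeasureTheory.volume) (a₀ := 0)
    (f := fun (x : (ℝ × ℝ) × ℝ) r => K x.2 r * f r (x.2 - x.1.1 + x.1.2)) hbody
    (s := fun x => x.2 - x.1.1 + x.1.2) (by fun_prop)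
  have hsub' := intervalIntegral.continuous_parametric_intervalIntegral_of_continuous
    (μ := MeasureTheory.volume) (a₀ := 0)
    (f := fun (x : (ℝ × ℝ) × ℝ) r => K x.2 r * f r (x.2 - x.1.1 + x.1.2)) hbody
    (s := fun x => x.2) (by fun_prop)
  refine (hsub.sub hsub').congr fun x => ?_
  have hx : Continuous fun r => K x.2 r * f r (x.2 - x.1.1 + x.1.2) :=
    hbody.comp (by fun_prop : Continuous fun r : ℝ => (x, r))
  exact intervalIntegral.integral_interval_sub_left (hx.intervalIntegrable _ _)
    (hx.intervalIntegrable _ _)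

lemma continuous_kernelOp {f K : ℝ → ℝ → ℝ} (hf : Continuous (Function.uncurry f))
    (hK : Continuous (Function.uncurry K)) :
    Continuous fun p : ℝ × ℝ => kernelOp f K p.1 p.2 := by
  have hinner := continuous_kernelOp_inner hf hK
  have hsub := intervalIntegral.continuous_parametric_intervalIntegral_of_continuous
    (μ := MeasureTheory.volume) (a₀ := 0)
    (f := fun (p : ℝ × ℝ) θ =>
      ∫ r in θ..(θ - p.1 + p.2), K θ r * f r (θ - p.1 + p.2)) hinner
    (s := fun p => p.1 + 1 - p.2) (by fun_prop)
  have hsub' := intervalIntegral.continuous_parametric_intervalIntegral_of_continuous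
    (μ := MeasureTheory.volume) (a₀ := 0)
    (f := fun (p : ℝ × ℝ) θ =>
      ∫ r in θ..(θ - p.1 + p.2), K θ r * f r (θ - p.1 + p.2)) hinner
    (s := fun p => p.1) (by fun_prop)
  refine (hsub.sub hsub').congr fun p => ?_
  have hp := hinner.comp (by fun_prop : Continuous fun θ : ℝ => (p, θ))
  exact intervalIntegral.integral_interval_sub_left (hp.intervalIntegrable _ _)
    (hp.intervalIntegrable _ _)

lemma continuous_kernelSource {f : ℝ → ℝ → ℝ} (hf : Continuous (Function.uncurry f)) :
    Continuous fun p : ℝ × ℝ => kernelSource f p.1 p.2 := by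
  have hbody : Continuous fun y : (ℝ × ℝ) × ℝ => f (y.2 + y.1.1 - y.1.2) y.2 :=
    hf.comp (by fun_prop : Continuous fun y : (ℝ × ℝ) × ℝ => (y.2 + y.1.1 - y.1.2, y.2))
  refine (intervalIntegral.continuous_parametric_intervalIntegral_of_continuous
    (μ := MeasureTheory.volume) (a₀ := 1)
    (f := fun (p : ℝ × ℝ) θ => f (θ + p.1 - p.2) θ) hbody
    (s := fun p => p.2) (by fun_prop)).neg.congr fun p => ?_
  exact (intervalIntegral.integral_symm _ _).symm

lemma kernelOp_sub {f K K' : ℝ → ℝ → ℝ} (hf : Continuous (Function.uncurry f))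
    (hK : Continuous (Function.uncurry K)) (hK' : Continuous (Function.uncurry K')) (s q : ℝ) :
    kernelOp f K s q - kernelOp f K' s q = kernelOp f (fun θ r => K θ r - K' θ r) s q := by
  have hθ {G : ℝ → ℝ → ℝ} (hG : Continuous (Function.uncurry G)) :=
    (continuous_kernelOp_inner hf hG).comp (by fun_prop : Continuous fun θ : ℝ => ((s, q), θ))
  have hr {G : ℝ → ℝ → ℝ} (hG : Continuous (Function.uncurry G)) (θ : ℝ) :
      Continuous fun r => G θ r * f r (θ - s + q) :=
    (hG.comp (by fun_prop : Continuous fun r : ℝ => (θ, r))).mul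
      (hf.comp (by fun_prop : Continuous fun r : ℝ => (r, θ - s + q)))
  unfold kernelOp
  refine (intervalIntegral.integral_sub ((hθ hK).intervalIntegrable _ _)
    ((hθ hK').intervalIntegrable _ _)).symm.trans ?_
  refine intervalIntegral.integral_congr fun θ _ => ?_
  refine (intervalIntegral.integral_sub ((hr hK θ).intervalIntegrable _ _)
    ((hr hK' θ).intervalIntegrable _ _)).symm.trans ?_
  simp only [sub_mul]

lemma abs_kernelOp_le {fbar M : ℝ} {f K : ℝ → ℝ → ℝ} (hM : 0 ≤ M)
    (hf : ∀ a ∈ Icc (0 : ℝ) 1, ∀ b ∈ Icc (0 : ℝ) 1, |f a b| ≤ fbar)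
    (hK : ∀ s q, (s, q) ∈ T1 → |K s q| ≤ M * Real.exp (fbar * (1 - s)))
    {s q : ℝ} (h : (s, q) ∈ T1) :
    |kernelOp f K s q| ≤ M * (Real.exp (fbar * (1 - s)) - 1) := by
  have hfbar : 0 ≤ fbar := (abs_nonneg _).trans (hf 0 (by simp) 0 (by simp))
  obtain ⟨h0, h1, h2⟩ := h
  dsimp only at h0 h1 h2
  have hinner : ∀ θ ∈ Ioc s (s + 1 - q),
      ‖∫ r in θ..(θ - s + q), K θ r * f r (θ - s + q)‖
        ≤ M * (fbar * Real.exp (fbar * (1 - θ))) := by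
    rintro θ ⟨ha, hb⟩
    have hC : 0 ≤ M * Real.exp (fbar * (1 - θ)) * fbar := by positivity
    refine (intervalIntegral.norm_integral_le_of_norm_le_const
      (C := M * Real.exp (fbar * (1 - θ)) * fbar) fun r hr => ?_).trans ?_
    · rw [uIoc_of_le (by linarith)] at hr
      obtain ⟨hc, hd⟩ := hr
      rw [norm_mul, Real.norm_eq_abs, Real.norm_eq_abs]
      exact mul_le_mul
        (hK θ r ⟨by dsimp only; linarith, hc.le, by dsimp only; linarith⟩)
        (hf r ⟨by linarith, by linarith⟩ _ ⟨by linarith, by linarith⟩) (abs_nonneg _)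
        (by positivity)
    · rw [abs_of_nonneg (by linarith)]
      nlinarith [mul_le_mul_of_nonneg_left (show θ - s + q - θ ≤ 1 by linarith) hC]
  have hderiv : ∀ θ : ℝ, HasDerivAt (fun θ => -(M * Real.exp (fbar * (1 - θ))))
      (M * (fbar * Real.exp (fbar * (1 - θ)))) θ := by
    intro θ
    have := ((((hasDerivAt_id θ).const_sub 1).const_mul fbar).exp.const_mul M).neg
    refine this.congr_deriv ?_
    simp only [id]
    ring
  have hint : IntervalIntegrable (fun θ => M * (fbar * Real.exp (fbar * (1 - θ))))
      MeasureTheory.volume s (s + 1 - q) :=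
    (by fun_prop : Continuous fun θ => M * (fbar * Real.exp (fbar * (1 - θ)))).intervalIntegrable
      _ _
  have hle := intervalIntegral.norm_integral_le_of_norm_le (by linarith)
    (Filter.Eventually.of_forall hinner) hint
  rw [intervalIntegral.integral_eq_sub_of_hasDerivAt (fun θ _ => hderiv θ) hint] at hle
  have hexp : 1 ≤ Real.exp (fbar * (1 - (s + 1 - q))) :=
    Real.one_le_exp (mul_nonneg hfbar (by linarith))
  refine hle.trans ?_
  nlinarith [mul_le_mul_of_nonneg_left hexp hM]

lemma abs_kernelSource_le {fbar : ℝ} {f : ℝ → ℝ → ℝ}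
    (hf : ∀ a ∈ Icc (0 : ℝ) 1, ∀ b ∈ Icc (0 : ℝ) 1, |f a b| ≤ fbar)
    {s q : ℝ} (h : (s, q) ∈ T1) : |kernelSource f s q| ≤ fbar := by
  have hfbar : 0 ≤ fbar := (abs_nonneg _).trans (hf 0 (by simp) 0 (by simp))
  obtain ⟨h0, h1, h2⟩ := h
  dsimp only at h0 h1 h2
  refine (intervalIntegral.norm_integral_le_of_norm_le_const (f := fun θ => f (θ + s - q) θ)
    (C := fbar) fun θ hθ => ?_).trans ?_
  · rw [uIoc_of_le h2] at hθ
    obtain ⟨ha, hb⟩ := hθ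
    exact hf _ ⟨by linarith, by linarith⟩ _ ⟨by linarith, hb⟩
  · rw [abs_of_nonneg (by linarith)]
    exact mul_le_of_le_one_right hfbar (by linarith)

lemma isCompact_T1 : IsCompact T1 := by
  refine (isCompact_Icc (a := ((0 : ℝ), (0 : ℝ))) (b := (1, 1))).of_isClosed_subset ?_ ?_
  · exact (isClosed_le continuous_const continuous_fst).inter
      ((isClosed_le continuous_fst continuous_snd).inter
        (isClosed_le continuous_snd continuous_const))
  · rintro ⟨s, q⟩ ⟨h0, h1, h2⟩
    exact ⟨⟨h0, h0.trans h1⟩, ⟨h1.trans h2, h2⟩⟩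

instance : CompactSpace T1 := isCompact_iff_compactSpace.mp isCompact_T1

/-- Truncation of a real number to the unit interval. -/
noncomputable def clampUnit (x : ℝ) : ℝ := max 0 (min 1 x)

lemma continuous_clampUnit : Continuous clampUnit := by
  unfold clampUnit; fun_prop

lemma clampUnit_mem (x : ℝ) : clampUnit x ∈ Icc (0 : ℝ) 1 :=
  ⟨le_max_left _ _, max_le zero_le_one (min_le_left _ _)⟩

lemma clampUnit_of_mem {x : ℝ} (hx : x ∈ Icc (0 : ℝ) 1) : clampUnit x = x := by
  rw [clampUnit, min_eq_right hx.2, max_eq_right hx.1]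

/-- A continuous retraction of the plane onto the triangle `T1`. -/
noncomputable def retractT1 (p : ℝ × ℝ) : T1 :=
  ⟨(max 0 (min p.1 (clampUnit p.2)), clampUnit p.2),
    le_max_left _ _, max_le (clampUnit_mem _).1 (min_le_right _ _), (clampUnit_mem _).2⟩

lemma continuous_retractT1 : Continuous retractT1 := by
  have := continuous_clampUnit
  unfold retractT1
  fun_prop

lemma retractT1_of_mem {p : ℝ × ℝ} (hp : p ∈ T1) : retractT1 p = ⟨p, hp⟩ := by
  obtain ⟨h0, h1, h2⟩ := hp
  apply Subtype.ext
  simp only [retractT1]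
  rw [clampUnit_of_mem ⟨h0.trans h1, h2⟩, min_eq_left h1, max_eq_right h0]

/-- The function on the plane obtained from `L` by composing with the retraction onto `T1` and
multiplying by the weight `exp (c * (1 - s))`. -/
noncomputable def weightedExtend (c : ℝ) (L : C(T1, ℝ)) (s q : ℝ) : ℝ :=
  L (retractT1 (s, q)) * Real.exp (c * (1 - s))

lemma continuous_weightedExtend (c : ℝ) (L : C(T1, ℝ)) :
    Continuous (Function.uncurry (weightedExtend c L)) := by
  have := continuous_retractT1
  unfold weightedExtend Function.uncurry
  fun_prop

lemma weightedExtend_of_mem (c : ℝ) (L : C(T1, ℝ)) {s q : ℝ} (h : (s, q) ∈ T1) :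
    weightedExtend c L s q = L ⟨(s, q), h⟩ * Real.exp (c * (1 - s)) := by
  rw [weightedExtend, retractT1_of_mem h]

/-- The right-hand side of the kernel equation, conjugated by the weight `exp (c * (1 - s))`. -/
noncomputable def weightedKernelMap (c : ℝ) {f : ℝ → ℝ → ℝ}
    (hf : Continuous (Function.uncurry f)) (L : C(T1, ℝ)) : C(T1, ℝ) where
  toFun p := (kernelOp f (weightedExtend c L) p.1.1 p.1.2 - kernelSource f p.1.1 p.1.2)
    * Real.exp (-(c * (1 - p.1.1)))
  continuous_toFun := by
    have h := ((continuous_kernelOp hf (continuous_weightedExtend c L)).sub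
      (continuous_kernelSource hf)).comp (continuous_subtype_val (p := (· ∈ T1)))
    exact h.mul (by fun_prop)

lemma contractingWith_weightedKernelMap {fbar : ℝ} {f : ℝ → ℝ → ℝ}
    (hfc : Continuous (Function.uncurry f))
    (hf : ∀ a ∈ Icc (0 : ℝ) 1, ∀ b ∈ Icc (0 : ℝ) 1, |f a b| ≤ fbar) :
    ContractingWith (Real.toNNReal (1 - Real.exp (-fbar))) (weightedKernelMap fbar hfc) := by
  have hfbar : 0 ≤ fbar := (abs_nonneg _).trans (hf 0 (by simp) 0 (by simp))
  have hexp : Real.exp (-fbar) ≤ 1 := Real.exp_le_one_iff.mpr (by linarith)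
  refine ⟨?_, LipschitzWith.of_dist_le_mul fun L L' => ?_⟩
  · rw [Real.toNNReal_lt_one]
    linarith [Real.exp_pos (-fbar)]
  rw [Real.coe_toNNReal _ (by linarith)]
  refine (ContinuousMap.dist_le (mul_nonneg (by linarith) dist_nonneg)).mpr ?_
  rintro ⟨⟨s, q⟩, h⟩
  have hdiff := abs_kernelOp_le (M := dist L L') dist_nonneg hf
    (K := fun θ r => weightedExtend fbar L θ r - weightedExtend fbar L' θ r)
    (fun s q h => by
      rw [weightedExtend_of_mem _ _ h, weightedExtend_of_mem _ _ h, ← sub_mul, abs_mul,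
        abs_of_pos (Real.exp_pos _)]
      rw [← Real.dist_eq]
      exact mul_le_mul_of_nonneg_right (ContinuousMap.dist_apply_le_dist _)
        (Real.exp_pos _).le) h
  rw [← kernelOp_sub hfc (continuous_weightedExtend _ _) (continuous_weightedExtend _ _)] at hdiff
  have hexp' : Real.exp (-fbar) ≤ Real.exp (-(fbar * (1 - s))) :=
    Real.exp_le_exp.mpr (by nlinarith [h.1])
  have hone : Real.exp (fbar * (1 - s)) * Real.exp (-(fbar * (1 - s))) = 1 := by
    rw [← Real.exp_add]; simp
  simp only [weightedKernelMap, ContinuousMap.coe_mk, Real.dist_eq]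
  rw [← sub_mul, sub_sub_sub_cancel_right, abs_mul, abs_of_pos (Real.exp_pos _)]
  calc _ ≤ dist L L' * (Real.exp (fbar * (1 - s)) - 1) * Real.exp (-(fbar * (1 - s))) :=
        mul_le_mul_of_nonneg_right hdiff (Real.exp_pos _).le
    _ = dist L L' * (1 - Real.exp (-(fbar * (1 - s)))) := by
        rw [mul_assoc, sub_mul, hone, one_mul]
    _ ≤ (1 - Real.exp (-fbar)) * dist L L' := by
        rw [mul_comm]
        exact mul_le_mul_of_nonneg_right (by linarith) dist_nonneg

lemma abs_le_of_kernel_equation {fbar : ℝ} {f K : ℝ → ℝ → ℝ}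
    (hf : ∀ a ∈ Icc (0 : ℝ) 1, ∀ b ∈ Icc (0 : ℝ) 1, |f a b| ≤ fbar)
    (hKc : ContinuousOn (Function.uncurry K) T1)
    (hK : ∀ s q, (s, q) ∈ T1 → K s q = kernelOp f K s q - kernelSource f s q)
    {s q : ℝ} (h : (s, q) ∈ T1) : |K s q| ≤ fbar * Real.exp (fbar * (1 - s)) := by
  have hcont : ContinuousOn
      (fun p : ℝ × ℝ => |Function.uncurry K p| * Real.exp (-(fbar * (1 - p.1)))) T1 :=
    hKc.abs.mul (by fun_prop : Continuous fun p : ℝ × ℝ =>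
      Real.exp (-(fbar * (1 - p.1)))).continuousOn
  obtain ⟨⟨a, b⟩, hab, hmax⟩ := isCompact_T1.exists_isMaxOn ⟨_, h⟩ hcont
  have hone (t : ℝ) : Real.exp (-(fbar * (1 - t))) * Real.exp (fbar * (1 - t)) = 1 := by
    rw [← Real.exp_add]; simp
  set M := |K a b| * Real.exp (-(fbar * (1 - a))) with hM
  have hbound : ∀ s q, (s, q) ∈ T1 → |K s q| ≤ M * Real.exp (fbar * (1 - s)) := by
    intro s q h
    have := mul_le_mul_of_nonneg_right (hmax h) (Real.exp_pos (fbar * (1 - s))).le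
    simp only [Function.uncurry_apply_pair] at this
    rwa [mul_assoc, hone, mul_one] at this
  have hattained : |K a b| = M * Real.exp (fbar * (1 - a)) := by
    rw [hM, mul_assoc, hone, mul_one]
  have hop := abs_kernelOp_le (by positivity : 0 ≤ M) hf hbound hab
  have hsum := abs_sub (kernelOp f K a b) (kernelSource f a b)
  rw [← hK a b hab] at hsum
  have hMle : M ≤ fbar := by linarith [abs_kernelSource_le hf hab]
  exact (hbound s q h).trans (mul_le_mul_of_nonneg_right hMle (Real.exp_pos _).le)

/-- For continuous f on [0,1]² with |f| ≤ f̄ there is exactly one continuous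
K on T₁ satisfying the kernel integral equation, and it satisfies
|K(s,q)| ≤ f̄ e^{f̄(1−s)} ≤ f̄ e^{f̄}. -/
theorem stmt_6 (fbar : ℝ) (f : ℝ → ℝ → ℝ)
    (hfc : ContinuousOn (Function.uncurry f) (Icc (0:ℝ) 1 ×ˢ Icc (0:ℝ) 1))
    (hfb : ∀ a ∈ Icc (0:ℝ) 1, ∀ b ∈ Icc (0:ℝ) 1, |f a b| ≤ fbar) :
    ∃ K : ℝ → ℝ → ℝ,
      ContinuousOn (Function.uncurry K) T1 ∧
      (∀ s q : ℝ, 0 ≤ s → s ≤ q → q ≤ 1 →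
        K s q = (∫ θ in s..(s + 1 - q), ∫ r in θ..(θ - s + q), K θ r * f r (θ - s + q))
          - ∫ θ in q..(1:ℝ), f (θ + s - q) θ) ∧
      (∀ K' : ℝ → ℝ → ℝ, ContinuousOn (Function.uncurry K') T1 →
        (∀ s q : ℝ, 0 ≤ s → s ≤ q → q ≤ 1 →
          K' s q = (∫ θ in s..(s + 1 - q), ∫ r in θ..(θ - s + q), K' θ r * f r (θ - s + q))
            - ∫ θ in q..(1:ℝ), f (θ + s - q) θ) →
        ∀ s q : ℝ, 0 ≤ s → s ≤ q → q ≤ 1 → K' s q = K s q) ∧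
      (∀ s q : ℝ, 0 ≤ s → s ≤ q → q ≤ 1 →
        |K s q| ≤ fbar * Real.exp (fbar * (1 - s)) ∧
        fbar * Real.exp (fbar * (1 - s)) ≤ fbar * Real.exp fbar) := by
  have hfbar : 0 ≤ fbar := (abs_nonneg _).trans (hfb 0 (by simp) 0 (by simp))
  set g : ℝ → ℝ → ℝ := fun a b => f (clampUnit a) (clampUnit b)
  have hfg : ∀ a ∈ Icc (0 : ℝ) 1, ∀ b ∈ Icc (0 : ℝ) 1, f a b = g a b := fun a ha b hb => by
    simp only [g, clampUnit_of_mem ha, clampUnit_of_mem hb]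
  have hgc : Continuous (Function.uncurry g) :=
    hfc.comp_continuous (f := fun p : ℝ × ℝ => (clampUnit p.1, clampUnit p.2))
      ((continuous_clampUnit.comp continuous_fst).prodMk
        (continuous_clampUnit.comp continuous_snd))
      fun p => ⟨clampUnit_mem _, clampUnit_mem _⟩
  have hgb : ∀ a ∈ Icc (0 : ℝ) 1, ∀ b ∈ Icc (0 : ℝ) 1, |g a b| ≤ fbar :=
    fun a _ b _ => hfb _ (clampUnit_mem a) _ (clampUnit_mem b)
  have hcontr := contractingWith_weightedKernelMap hgc hgb
  have hone (t : ℝ) : Real.exp (-(fbar * (1 - t))) * Real.exp (fbar * (1 - t)) = 1 := by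
    rw [← Real.exp_add]; simp
  obtain ⟨L, hL⟩ : ∃ L, Function.IsFixedPt (weightedKernelMap fbar hgc) L :=
    ⟨_, hcontr.fixedPoint_isFixedPt⟩
  have hcont : ContinuousOn (Function.uncurry (weightedExtend fbar L)) T1 :=
    (continuous_weightedExtend fbar L).continuousOn
  have heq : ∀ s q, (s, q) ∈ T1 → weightedExtend fbar L s q =
      kernelOp f (weightedExtend fbar L) s q - kernelSource f s q := by
    intro s q h
    rw [kernelOp_congr hfg (fun _ _ _ => rfl) h, kernelSource_congr hfg h,
      weightedExtend_of_mem _ _ h]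
    have hp := DFunLike.congr_fun hL.eq ⟨(s, q), h⟩
    rw [← hp]
    simp only [weightedKernelMap, ContinuousMap.coe_mk]
    rw [mul_assoc, hone, mul_one]
  refine ⟨weightedExtend fbar L, hcont, fun s q h0 h1 h2 => heq s q ⟨h0, h1, h2⟩, ?_, ?_⟩
  · intro K' hK'c hK' s q h0 h1 h2
    have h : (s, q) ∈ T1 := ⟨h0, h1, h2⟩
    let L' : C(T1, ℝ) :=
      ⟨fun p => K' p.1.1 p.1.2 * Real.exp (-(fbar * (1 - p.1.1))),
        (hK'c.comp_continuous continuous_subtype_val Subtype.property).mul (by fun_prop)⟩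
    have hL' (p : T1) : L' p = K' p.1.1 p.1.2 * Real.exp (-(fbar * (1 - p.1.1))) := rfl
    have hext : ∀ s q, (s, q) ∈ T1 → K' s q = weightedExtend fbar L' s q := by
      intro s q h
      rw [weightedExtend_of_mem _ _ h, hL', mul_assoc, hone, mul_one]
    have hfix : Function.IsFixedPt (weightedKernelMap fbar hgc) L' := by
      refine ContinuousMap.ext ?_
      rintro ⟨⟨s, q⟩, h⟩
      rw [hL']
      simp only [weightedKernelMap, ContinuousMap.coe_mk]
      rw [← kernelOp_congr hfg hext h, ← kernelSource_congr hfg h]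
      congr 1
      exact (hK' s q h.1 h.2.1 h.2.2).symm
    rw [hext s q h, hcontr.fixedPoint_unique' hfix hL]
  · intro s q h0 h1 h2
    refine ⟨abs_le_of_kernel_equation hfb hcont heq ⟨h0, h1, h2⟩,
      mul_le_mul_of_nonneg_left (Real.exp_le_exp.mpr ?_) hfbar⟩
    nlinarith
end
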